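/- arXiv:math/0104232 — 2 statements merged into one kernel-verified Lean document; each statement's English description precedes it below -/
import Mathlib

section
/- Let O(p,q) denote the group of linear automorphisms A of ℝⁿ preserving the quadratic form Σ_i ε_i (x^i)². Every real polynomial P(x,ξ) in the 2n variables (x^1,…,x^n, ξ_1,…,ξ_n) that is invariant under the action (x,ξ) ↦ (Ax, ξ∘A^{−1}) of O(p,q) is a polynomial in the three invariants R_xx = Σ_i ε_i (x^i)², R_xξ = Σ_i x^i ξ_i, and R_ξξ = Σ_i ε_i ξ_i². -/
open MvPolynomial

noncomputable section

/-- `ε_i = 1` for `i < p`, `ε_i = -1` for `i ≥ p`. -/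
def eps (p : ℕ) {n : ℕ} (i : Fin n) : ℝ := if (i : ℕ) < p then 1 else -1

/-- A polynomial vanishing on a neighbourhood is zero. -/
lemma poly_zero_of_nhds {σ : Type} [Fintype σ] (F : MvPolynomial σ ℝ) (U : Set (σ → ℝ))
    (hU : IsOpen U) (z : σ → ℝ) (hz : z ∈ U) (h : ∀ x ∈ U, eval x F = 0) : F = 0 := by
  obtain ⟨r, hr, hb⟩ := Metric.isOpen_iff.1 hU z hz
  refine MvPolynomial.funext_set (fun i => Metric.ball (z i) r) (fun i => ?_) ?_
  · rw [Real.ball_eq_Ioo]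
    exact Set.Ioo_infinite (by linarith)
  · intro x hx
    rw [map_zero]
    apply h x (hb _)
    rw [ball_pi z hr]
    exact hx

lemma eps_sq (p : ℕ) {n : ℕ} (i : Fin n) : eps p i * eps p i = 1 := by
  unfold eps; split_ifs <;> norm_num

/-- The symmetric bilinear form of signature (p,q). -/
def Bf (p : ℕ) {n : ℕ} (x y : Fin n → ℝ) : ℝ := ∑ i, eps p i * x i * y i

lemma Bf_comm (p : ℕ) {n : ℕ} (x y : Fin n → ℝ) : Bf p x y = Bf p y x := by
  unfold Bf; exact Finset.sum_congr rfl fun i _ => by ring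

lemma Bf_sub (p : ℕ) {n : ℕ} (x y z : Fin n → ℝ) : Bf p (x - y) z = Bf p x z - Bf p y z := by
  unfold Bf; rw [← Finset.sum_sub_distrib]
  exact Finset.sum_congr rfl fun i _ => by simp only [Pi.sub_apply]; ring

lemma Bf_add (p : ℕ) {n : ℕ} (x y z : Fin n → ℝ) : Bf p (x + y) z = Bf p x z + Bf p y z := by
  unfold Bf; rw [← Finset.sum_add_distrib]
  exact Finset.sum_congr rfl fun i _ => by simp only [Pi.add_apply]; ring

lemma Bf_smul (p : ℕ) {n : ℕ} (c : ℝ) (x z : Fin n → ℝ) : Bf p (c • x) z = c * Bf p x z := by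
  unfold Bf; rw [Finset.mul_sum]
  exact Finset.sum_congr rfl fun i _ => by simp only [Pi.smul_apply, smul_eq_mul]; ring

lemma Bf_sub' (p : ℕ) {n : ℕ} (x y z : Fin n → ℝ) : Bf p z (x - y) = Bf p z x - Bf p z y := by
  rw [Bf_comm, Bf_sub, Bf_comm p x, Bf_comm p y]

lemma Bf_add' (p : ℕ) {n : ℕ} (x y z : Fin n → ℝ) : Bf p z (x + y) = Bf p z x + Bf p z y := by
  rw [Bf_comm, Bf_add, Bf_comm p x, Bf_comm p y]

lemma Bf_smul' (p : ℕ) {n : ℕ} (c : ℝ) (x z : Fin n → ℝ) : Bf p z (c • x) = c * Bf p z x := by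
  rw [Bf_comm, Bf_smul, Bf_comm p x]

lemma Bf_single (p : ℕ) {n : ℕ} (i : Fin n) (x : Fin n → ℝ) :
    Bf p x (Pi.single i 1) = eps p i * x i := by
  unfold Bf
  rw [Finset.sum_eq_single i]
  · simp
  · intro j _ hj; simp [hj]
  · simp

/-- Reflection in the hyperplane orthogonal to `z`. -/
def Rf (p : ℕ) {n : ℕ} (z x : Fin n → ℝ) : Fin n → ℝ := x - (2 * Bf p x z / Bf p z z) • z

lemma Bf_Rf (p : ℕ) {n : ℕ} (z x y : Fin n → ℝ) (hz : Bf p z z ≠ 0) :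
    Bf p (Rf p z x) (Rf p z y) = Bf p x y := by
  simp only [Rf, Bf_sub, Bf_sub', Bf_smul, Bf_smul']
  rw [Bf_comm p z y]
  field_simp
  ring

lemma Rf_Rf (p : ℕ) {n : ℕ} (z x : Fin n → ℝ) (hz : Bf p z z ≠ 0) :
    Rf p z (Rf p z x) = x := by
  have : Bf p (Rf p z x) z = - Bf p x z := by
    simp only [Rf, Bf_sub, Bf_smul]; field_simp; ring
  rw [Rf, this, Rf]
  ext i; simp; ring

/-- The matrix of the reflection. -/
def RM (p : ℕ) {n : ℕ} (z : Fin n → ℝ) : Matrix (Fin n) (Fin n) ℝ :=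
  1 - (2 / Bf p z z) • Matrix.vecMulVec z (fun j => eps p j * z j)

lemma RM_mulVec (p : ℕ) {n : ℕ} (z x : Fin n → ℝ) : (RM p z).mulVec x = Rf p z x := by
  have h : (fun j => eps p j * z j) ⬝ᵥ x = Bf p x z := by
    unfold Bf dotProduct; exact Finset.sum_congr rfl fun i _ => by ring
  rw [RM, Matrix.sub_mulVec, Matrix.one_mulVec, Matrix.smul_mulVec, Matrix.vecMulVec_mulVec, h, Rf]
  ext i; simp; ring

lemma RM_vecMul (p : ℕ) {n : ℕ} (z y : Fin n → ℝ) :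
    Matrix.vecMul (fun i => eps p i * y i) (RM p z) = fun i => eps p i * Rf p z y i := by
  have h : (fun i => eps p i * y i) ⬝ᵥ z = Bf p y z := by
    unfold Bf dotProduct; exact Finset.sum_congr rfl fun i _ => by ring
  rw [RM, Matrix.vecMul_sub, Matrix.vecMul_one, Matrix.vecMul_smul, Matrix.vecMul_vecMulVec, h]
  ext i; simp [Rf]; ring

lemma RM_mul (p : ℕ) {n : ℕ} (z : Fin n → ℝ) (hz : Bf p z z ≠ 0) : RM p z * RM p z = 1 := by
  apply Matrix.mulVec_injective
  ext1 x
  rw [← Matrix.mulVec_mulVec, RM_mulVec, RM_mulVec, Rf_Rf p z x hz, Matrix.one_mulVec]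

/-- `P` as a function of two vectors. -/
def Gf (p : ℕ) {n : ℕ} (P : MvPolynomial (Fin n ⊕ Fin n) ℝ) (x y : Fin n → ℝ) : ℝ :=
  eval (Sum.elim x (fun i => eps p i * y i)) P

lemma Gf_refl (p n : ℕ) (P : MvPolynomial (Fin n ⊕ Fin n) ℝ)
    (hP : ∀ A : GL (Fin n) ℝ,
      (∀ v : Fin n → ℝ,
        ∑ i, eps p i * (Matrix.mulVec (A : Matrix (Fin n) (Fin n) ℝ) v i) ^ 2
          = ∑ i, eps p i * (v i) ^ 2) →
      ∀ x ξ : Fin n → ℝ,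
        eval (Sum.elim (Matrix.mulVec (A : Matrix (Fin n) (Fin n) ℝ) x)
            (Matrix.vecMul ξ ((A⁻¹ : GL (Fin n) ℝ) : Matrix (Fin n) (Fin n) ℝ))) P
          = eval (Sum.elim x ξ) P) (z : Fin n → ℝ) (hz : Bf p z z ≠ 0) (x y : Fin n → ℝ) :
    Gf p P (Rf p z x) (Rf p z y) = Gf p P x y := by
  have hB : ∀ v : Fin n → ℝ, ∑ i, eps p i * (v i) ^ 2 = Bf p v v := fun v => by
    unfold Bf; exact Finset.sum_congr rfl fun i _ => by ring
  have := hP ⟨RM p z, RM p z, RM_mul p z hz, RM_mul p z hz⟩ (by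
    intro v
    simp only [RM_mulVec, hB]
    exact Bf_Rf p z v v hz) x (fun i => eps p i * y i)
  simp only [Units.inv_mk, RM_mulVec, RM_vecMul] at this
  exact this

lemma even_poly (e0 e1 : ℝ) (h0 : e0 * e0 = 1) (h1 : e1 * e1 = 1) (f : MvPolynomial (Fin 3) ℝ) :
    ∃ (N : ℕ) (Q : MvPolynomial (Fin 3) ℝ), ∀ a b c : ℝ,
      (e0 * a ^ 2) ^ N * (eval ![a, b, c] f + eval ![-a, -b, c] f + eval ![a, b, -c] f
        + eval ![-a, -b, -c] f) = eval ![e0 * a ^ 2, e0 * a * b, e0 * b ^ 2 + e1 * c ^ 2] Q := by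
  induction f using MvPolynomial.induction_on' with
  | monomial s r =>
    have hs : ∀ a b c : ℝ, eval ![a, b, c] (monomial s r) = r * (a ^ s 0 * b ^ s 1 * c ^ s 2) := by
      intro a b c
      rw [eval_monomial, Finsupp.prod_fintype _ _ (by simp), Fin.prod_univ_three]; simp
    simp only [hs]
    generalize s 0 = i
    generalize s 1 = j
    generalize s 2 = k
    rcases Nat.even_or_odd (i + j) with hij | hij
    · rcases Nat.even_or_odd k with hk | hk
      · obtain ⟨l, rfl⟩ := hk
        obtain ⟨m, hm⟩ := hij
        refine ⟨j + l, C (4 * r) * (C e0 * X 0) ^ m * (C e0 * X 1) ^ j * (C (e0 * e1) * (X 0 * X 2 - X 1 ^ 2)) ^ l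
          * C (e0 ^ (j + l)), fun a b c => ?_⟩
        have e1' : (e0 * (e0 * a ^ 2)) = a ^ 2 := by linear_combination a ^ 2 * h0
        have e2' : (e0 * (e0 * a * b)) = a * b := by linear_combination a * b * h0
        have e3' : (e0 * e1 * (e0 * a ^ 2 * (e0 * b ^ 2 + e1 * c ^ 2) - (e0 * a * b) ^ 2))
            = (a * c) ^ 2 := by
          linear_combination e1 * e1 * a ^ 2 * c ^ 2 * h0 + a ^ 2 * c ^ 2 * h1
        have sgn : (-1 : ℝ) ^ i * (-1) ^ j = 1 := by
          rw [← pow_add, hm, ← two_mul, pow_mul]; simp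
        have sgn2 : (-1 : ℝ) ^ (l + l) = 1 := by rw [← two_mul, pow_mul]; simp
        simp only [map_mul, map_pow, map_sub, eval_C, eval_X, Matrix.cons_val_zero,
          Matrix.cons_val_one, Matrix.cons_val, e1', e2', e3']
        have ha : (a ^ 2) ^ m = a ^ i * a ^ j := by
          rw [← pow_add, hm, ← two_mul, pow_mul]
        rw [ha, neg_pow a, neg_pow b, neg_pow c, sgn2]
        have e4 : (-1) ^ i * a ^ i * ((-1) ^ j * b ^ j) = a ^ i * b ^ j := by
          linear_combination a ^ i * b ^ j * sgn
        rw [e4]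
        ring
      · refine ⟨0, 0, fun a b c => ?_⟩
        rw [hk.neg_pow]; simp
    · have hz : ∀ a b : ℝ, (-a) ^ i * (-b) ^ j = - (a ^ i * b ^ j) := by
        intro a b
        rw [neg_pow a, neg_pow b]
        have : (-1 : ℝ) ^ i * (-1) ^ j = -1 := by rw [← pow_add, hij.neg_one_pow]
        linear_combination a ^ i * b ^ j * this
      refine ⟨0, 0, fun a b c => ?_⟩
      rw [hz]; simp
  | add f g hf hg =>
    obtain ⟨N, Q, hQ⟩ := hf
    obtain ⟨M, R, hR⟩ := hg
    refine ⟨N + M, X 0 ^ M * Q + X 0 ^ N * R, fun a b c => ?_⟩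
    simp only [map_add, map_mul, map_pow, eval_X, ← hQ, ← hR, Matrix.cons_val_zero]
    ring

/-- The three invariants. -/
def Inv3 (p n : ℕ) : Fin 3 → MvPolynomial (Fin n ⊕ Fin n) ℝ :=
  ![∑ i, C (eps p i) * X (Sum.inl i) ^ 2,
          ∑ i, X (Sum.inl i) * X (Sum.inr i),
          ∑ i, C (eps p i) * X (Sum.inr i) ^ 2]

lemma split_X0 (Q : MvPolynomial (Fin 3) ℝ) :
    ∃ Q1, Q = X 0 * Q1 + aeval ![0, X 1, X 2] Q := by
  induction Q using MvPolynomial.induction_on with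
  | C a => exact ⟨0, by simp⟩
  | add f g hf hg =>
    obtain ⟨f1, h1⟩ := hf
    obtain ⟨g1, h2⟩ := hg
    refine ⟨f1 + g1, ?_⟩
    rw [map_add]
    linear_combination h1 + h2
  | mul_X f i hf =>
    obtain ⟨f1, h1⟩ := hf
    rw [map_mul, aeval_X]
    fin_cases i
    · exact ⟨f, by simp; ring⟩
    · exact ⟨f1 * X 1, by
        simp only [Fin.mk_one, Matrix.cons_val_one, Matrix.cons_val_zero]
        linear_combination X 1 * h1⟩
    · exact ⟨f1 * X 2, by
        simp only [Fin.reduceFinMk, Matrix.cons_val]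
        linear_combination X 2 * h1⟩

lemma complex_point (p m : ℕ) (v w : ℂ) (hv : v ≠ 0) :
    ∃ g : Fin (m + 2) ⊕ Fin (m + 2) → ℂ, ∀ k, aeval g (Inv3 p (m + 2) k) = ![0, v, w] k := by
  obtain ⟨ω, hω⟩ : ∃ ω : ℂ, ω ^ 2 = -((eps p (0 : Fin (m+2)) : ℝ) : ℂ) * (eps p (1 : Fin (m+2)) : ℝ) :=
    IsAlgClosed.exists_pow_nat_eq _ (by norm_num)
  have h0 : ((eps p (0 : Fin (m+2)) : ℝ) : ℂ) * (eps p (0 : Fin (m+2)) : ℝ) = 1 := by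
    exact_mod_cast eps_sq p (0 : Fin (m+2))
  have h1 : ((eps p (1 : Fin (m+2)) : ℝ) : ℂ) * (eps p (1 : Fin (m+2)) : ℝ) = 1 := by
    exact_mod_cast eps_sq p (1 : Fin (m+2))
  have hi : v * v⁻¹ = 1 := mul_inv_cancel₀ hv
  set e0 : ℂ := ((eps p (0 : Fin (m+2)) : ℝ) : ℂ) with he0
  set e1 : ℂ := ((eps p (1 : Fin (m+2)) : ℝ) : ℂ) with he1
  set u := v⁻¹
  -- the covector has entries (σ, τ, 0, …) with σ + ω τ = v
  refine ⟨Sum.elim (Fin.cons 1 (Fin.cons ω 0))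
    (Fin.cons ((v + e0 * w * u) / 2) (Fin.cons (-e0 * e1 * ω * (v - e0 * w * u) / 2) 0)), ?_⟩
  have hω4 : ω ^ 2 * ω ^ 2 = 1 := by rw [hω]; linear_combination e1 * e1 * h0 + h1
  intro k
  fin_cases k
  · simp [Inv3, Fin.sum_univ_succ, ← he0, ← he1, hω]
    linear_combination -e0 * h1
  · simp [Inv3, Fin.sum_univ_succ, ← he0, ← he1]
    linear_combination (-e0 * e1 * (v - e0 * w * u) / 2) * hω
      + (v - e0 * w * u) / 2 * (e1 * e1 * h0 + h1)
  · simp [Inv3, Fin.sum_univ_succ, ← he0, ← he1]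
    set D := (v - e0 * w * u) / 2 with hD
    have hD' : -(e0 * e1 * ω * (v - e0 * w * u)) / 2 = - e0 * e1 * ω * D := by rw [hD]; ring
    rw [hD']
    have hDD : D ^ 2 = (v - e0 * w * u) ^ 2 / 4 := by rw [hD]; ring
    linear_combination e1 * e0 ^ 2 * e1 ^ 2 * D ^ 2 * hω - e0 * e1 ^ 4 * D ^ 2 * h0
      - e0 * D ^ 2 * (e1 ^ 2 + 1) * h1 - e0 * hDD + w * v * u * h0 + w * hi

lemma descend (p m : ℕ) (N : ℕ) (P : MvPolynomial (Fin (m + 2) ⊕ Fin (m + 2)) ℝ) :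
    ∀ (Q : MvPolynomial (Fin 3) ℝ), Inv3 p (m + 2) 0 ^ N * P = aeval (Inv3 p (m + 2)) Q →
    ∃ Q : MvPolynomial (Fin 3) ℝ, P = aeval (Inv3 p (m + 2)) Q := by
  have hne : Inv3 p (m + 2) 0 ≠ 0 := by
    intro h
    have := congrArg (eval (Sum.elim (Pi.single 0 1) 0)) h
    simp [Inv3, Fin.sum_univ_succ] at this
    have h2 := eps_sq p (0 : Fin (m+2))
    rw [this] at h2
    simp at h2
  induction N with
  | zero => exact fun Q h => ⟨Q, by simpa using h⟩
  | succ N ih =>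
    intro Q h
    obtain ⟨Q1, hQ1⟩ := split_X0 Q
    have hz : (X 1 : MvPolynomial (Fin 3) ℝ) * aeval ![0, X 1, X 2] Q = 0 := by
      apply MvPolynomial.map_injective (algebraMap ℝ ℂ) (algebraMap ℝ ℂ).injective
      apply MvPolynomial.funext
      intro t
      rw [map_zero, map_zero, map_mul, map_mul, eval_map, eval_map, eval₂_X]
      by_cases ht : t 1 = 0
      · rw [ht, zero_mul]
      · obtain ⟨g, hg⟩ := complex_point p m (t 1) (t 2) ht
        have h2 := congrArg (aeval g) h
        rw [map_mul, map_pow, hg 0] at h2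
        have h3 : aeval g (aeval (Inv3 p (m + 2)) Q) = aeval ![0, t 1, t 2] Q := by
          rw [← AlgHom.comp_apply, comp_aeval]
          congr 2
          ext k; exact hg k
        have h4 : eval₂ (algebraMap ℝ ℂ) t (aeval ![0, X 1, X 2] Q) = aeval ![0, t 1, t 2] Q := by
          change aeval t _ = _
          rw [← AlgHom.comp_apply, comp_aeval]
          congr 2
          ext k; fin_cases k <;> simp
        rw [h4, ← h3, ← h2]
        simp
    have hz2 := (mul_eq_zero.1 hz).resolve_left (X_ne_zero 1)
    rw [hz2, add_zero] at hQ1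
    refine ih Q1 ?_
    rw [hQ1, map_mul, aeval_X, pow_succ'] at h
    apply mul_left_cancel₀ hne
    rw [← h]; ring

/-- A reflection carrying `x` to `± w`. -/
lemma exists_refl (p : ℕ) {n : ℕ} (x w : Fin n → ℝ) (h : Bf p x x = Bf p w w)
    (hx : Bf p x x ≠ 0) : ∃ s : ℝ, s * s = 1 ∧ Bf p (x - s • w) (x - s • w) ≠ 0 ∧
      Rf p (x - s • w) x = s • w := by
  have hz : ∀ s : ℝ, s * s = 1 →
      Bf p (x - s • w) (x - s • w) = 2 * Bf p x (x - s • w) := by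
    intro s hs
    simp only [Bf_sub, Bf_sub', Bf_smul, Bf_smul']
    rw [Bf_comm p w x, ← h]
    linear_combination Bf p x x * hs
  have key : ∀ s : ℝ, s * s = 1 → Bf p (x - s • w) (x - s • w) ≠ 0 →
      Rf p (x - s • w) x = s • w := by
    intro s hs hne
    rw [Rf, ← hz s hs, div_self hne, one_smul, sub_sub_cancel]
  by_cases h1 : Bf p (x - (1 : ℝ) • w) (x - (1 : ℝ) • w) = 0
  · refine ⟨-1, by norm_num, ?_, key _ (by norm_num) ?_⟩ <;>
    · rw [hz _ (by norm_num)] at h1 ⊢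
      simp only [Bf_sub', Bf_smul'] at h1 ⊢
      intro h2
      apply hx
      linarith
  · exact ⟨1, by norm_num, h1, key _ (by norm_num) h1⟩

/-- Standard basis vector. -/
def bv {n : ℕ} (i : Fin n) : Fin n → ℝ := Pi.single i 1

lemma Bf_bv (p : ℕ) {n : ℕ} (i : Fin n) (x : Fin n → ℝ) : Bf p x (bv i) = eps p i * x i :=
  Bf_single p i x

lemma Bf_bv' (p : ℕ) {n : ℕ} (i : Fin n) (x : Fin n → ℝ) : Bf p (bv i) x = eps p i * x i := by
  rw [Bf_comm, Bf_bv]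

lemma transport (p m : ℕ) (P : MvPolynomial (Fin (m + 2) ⊕ Fin (m + 2)) ℝ)
    (hG : ∀ z, Bf p z z ≠ 0 → ∀ x y, Gf p P (Rf p z x) (Rf p z y) = Gf p P x y)
    (x y : Fin (m + 2) → ℝ) (hx : 0 < eps p (0 : Fin (m + 2)) * Bf p x x)
    (hxy : 0 < eps p (0 : Fin (m + 2)) * eps p (1 : Fin (m + 2)) *
      (Bf p x x * Bf p y y - Bf p x y ^ 2)) :
    ∃ a b c : ℝ, Gf p P x y = Gf p P (a • bv 0) (b • bv 0 + c • bv 1) ∧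
      Bf p x x = eps p (0 : Fin (m + 2)) * a ^ 2 ∧
      Bf p x y = eps p (0 : Fin (m + 2)) * a * b ∧
      Bf p y y = eps p (0 : Fin (m + 2)) * b ^ 2 + eps p (1 : Fin (m + 2)) * c ^ 2 := by
  have h0 := eps_sq p (0 : Fin (m + 2))
  have h1 := eps_sq p (1 : Fin (m + 2))
  have b00 : (bv 0 : Fin (m + 2) → ℝ) 0 = 1 := by simp [bv]
  have b11 : (bv 1 : Fin (m + 2) → ℝ) 1 = 1 := by simp [bv]
  have b01 : (bv 0 : Fin (m + 2) → ℝ) 1 = 0 := by simp [bv]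
  have b10 : (bv 1 : Fin (m + 2) → ℝ) 0 = 0 := by simp [bv]
  set e0 := eps p (0 : Fin (m + 2)) with he0
  set e1 := eps p (1 : Fin (m + 2)) with he1
  obtain ⟨a, ha⟩ : ∃ a : ℝ, a ^ 2 = e0 * Bf p x x := ⟨_, Real.sq_sqrt hx.le⟩
  have hxa : Bf p x x = e0 * a ^ 2 := by rw [ha]; linear_combination - Bf p x x * h0
  have hxne : Bf p x x ≠ 0 := by
    intro h; rw [h] at hx; simp at hx
  obtain ⟨s, hs, hz, hR⟩ := exists_refl p x (a • bv 0) (by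
    rw [Bf_smul, Bf_smul', Bf_bv, b00, hxa]; ring) hxne
  set z := x - s • (a • bv 0) with hzdef
  set y1 := Rf p z y with hy1
  have hGe := hG z hz x y
  have Bxy := Bf_Rf p z x y hz
  have Byy := Bf_Rf p z y y hz
  rw [hR, ← hy1] at Bxy hGe
  rw [← hy1] at Byy
  set b := y1 0 with hb
  have Bxy' : Bf p x y = e0 * (s * a) * b := by
    rw [← Bxy, Bf_smul, Bf_smul, Bf_bv']; ring
  set y2 := y1 - b • bv 0 with hy2
  have hy20 : y2 0 = 0 := by simp [hy2, b00, hb]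
  have By2 : Bf p y2 y2 = Bf p y y - e0 * b ^ 2 := by
    rw [← Byy, hy2]
    rw [Bf_sub' p, Bf_smul', Bf_bv, ← hy2, hy20, hy2, Bf_sub, Bf_smul, Bf_bv', ← hb, ← he0]
    ring
  have hpos : 0 < e1 * Bf p y2 y2 := by
    have : e0 * e1 * (Bf p x x * Bf p y y - Bf p x y ^ 2) = a ^ 2 * (e1 * Bf p y2 y2) := by
      rw [Bxy', By2, hxa]
      linear_combination (a ^ 2 * e1 * Bf p y y - e0 * e1 * s * s * a ^ 2 * b ^ 2) * h0
        - e0 * e1 * a ^ 2 * b ^ 2 * hs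
    rw [this] at hxy
    exact pos_of_mul_pos_right hxy (sq_nonneg a)
  obtain ⟨c, hc⟩ : ∃ c : ℝ, c ^ 2 = e1 * Bf p y2 y2 := ⟨_, Real.sq_sqrt hpos.le⟩
  have hyc : Bf p y2 y2 = e1 * c ^ 2 := by rw [hc]; linear_combination - Bf p y2 y2 * h1
  have hyne : Bf p y2 y2 ≠ 0 := by
    intro h; rw [h] at hpos; simp at hpos
  obtain ⟨t, ht, hz2, hR2⟩ := exists_refl p y2 (c • bv 1) (by
    rw [Bf_smul, Bf_smul', Bf_bv, b11, hyc]; ring) hyne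
  set z2 := y2 - t • (c • bv 1) with hz2def
  have hz20 : z2 0 = 0 := by simp [hz2def, hy20, b10]
  have hfix : ∀ r : ℝ, Bf p (r • bv 0) z2 = 0 := by
    intro r; rw [Bf_smul, Bf_bv', hz20]; simp
  have hGe2 := hG z2 hz2 (s • a • bv 0) y1
  have r1 : Rf p z2 (s • a • bv 0) = (s * a) • bv 0 := by
    rw [smul_smul, Rf, hfix]; simp
  have r2 : Rf p z2 y1 = b • bv 0 + (t * c) • bv 1 := by
    have : y1 = b • bv 0 + y2 := by rw [hy2]; abel
    rw [mul_smul, ← hR2, this, Rf, Rf, Bf_add, hfix, zero_add]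
    abel
  rw [r1, r2] at hGe2
  refine ⟨s * a, b, t * c, by rw [hGe2, hGe], ?_, Bxy', ?_⟩
  · rw [hxa]; linear_combination - e0 * a ^ 2 * hs
  · linear_combination -By2 + hyc - e1 * c ^ 2 * ht

lemma eval_inv (p n : ℕ) (x y : Fin n → ℝ) (k : Fin 3) :
    eval (Sum.elim x (fun i => eps p i * y i)) (Inv3 p n k)
      = ![Bf p x x, Bf p x y, Bf p y y] k := by
  fin_cases k
  · simp only [Inv3, Bf, Fin.zero_eta, Matrix.cons_val_zero, map_sum, map_mul, map_pow, eval_C,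
      eval_X, Sum.elim_inl]
    exact Finset.sum_congr rfl fun i _ => by ring
  · simp only [Inv3, Bf, Fin.mk_one, Matrix.cons_val_one, Matrix.cons_val_zero, map_sum, map_mul,
      eval_X, Sum.elim_inl, Sum.elim_inr]
    exact Finset.sum_congr rfl fun i _ => by ring
  · simp only [Inv3, Bf, Fin.reduceFinMk, Matrix.cons_val, map_sum, map_mul, map_pow, eval_C,
      eval_X, Sum.elim_inr]
    exact Finset.sum_congr rfl fun i _ => by
      linear_combination eps p i * y i ^ 2 * eps_sq p i

lemma eval_aeval_inv (p n : ℕ) (x y : Fin n → ℝ) (Q : MvPolynomial (Fin 3) ℝ) :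
    eval (Sum.elim x (fun i => eps p i * y i)) (aeval (Inv3 p n) Q)
      = eval ![Bf p x x, Bf p x y, Bf p y y] Q := by
  rw [← coe_aeval_eq_eval, ← coe_aeval_eq_eval]
  change aeval _ (aeval _ Q) = aeval _ Q
  rw [← AlgHom.comp_apply, comp_aeval]
  congr 2
  ext k
  exact eval_inv p n x y k

lemma slice (p m : ℕ) (P : MvPolynomial (Fin (m + 2) ⊕ Fin (m + 2)) ℝ) :
    ∃ f : MvPolynomial (Fin 3) ℝ, ∀ a b c : ℝ,
      Gf p P (a • bv 0) (b • bv 0 + c • bv 1) = eval ![a, b, c] f := by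
  refine ⟨aeval (Sum.elim (fun i => C (bv 0 i) * X 0)
    (fun i => C (eps p i) * (C (bv 0 i) * X 1 + C (bv 1 i) * X 2))) P, fun a b c => ?_⟩
  rw [Gf, ← coe_aeval_eq_eval, ← coe_aeval_eq_eval]
  change aeval _ P = aeval _ (aeval _ P)
  rw [← AlgHom.comp_apply, comp_aeval]
  congr 2
  ext k
  rcases k with k | k
  · simp; ring
  · simp only [Sum.elim_inr, Pi.add_apply, Pi.smul_apply, smul_eq_mul, map_mul, map_add, aeval_C,
      aeval_X, Matrix.cons_val_one, Matrix.cons_val_zero, Matrix.cons_val, Algebra.algebraMap_self,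
      RingHom.id_apply]
    ring

lemma case_ge_two (p m : ℕ) (P : MvPolynomial (Fin (m + 2) ⊕ Fin (m + 2)) ℝ)
    (hG : ∀ z, Bf p z z ≠ 0 → ∀ x y, Gf p P (Rf p z x) (Rf p z y) = Gf p P x y) :
    ∃ Q : MvPolynomial (Fin 3) ℝ, P = aeval (Inv3 p (m + 2)) Q := by
  have h0 := eps_sq p (0 : Fin (m + 2))
  have h1 := eps_sq p (1 : Fin (m + 2))
  have b00 : (bv 0 : Fin (m + 2) → ℝ) 0 = 1 := by simp [bv]
  have b11 : (bv 1 : Fin (m + 2) → ℝ) 1 = 1 := by simp [bv]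
  have b01 : (bv 0 : Fin (m + 2) → ℝ) 1 = 0 := by simp [bv]
  have b10 : (bv 1 : Fin (m + 2) → ℝ) 0 = 0 := by simp [bv]
  set e0 := eps p (0 : Fin (m + 2)) with he0
  set e1 := eps p (1 : Fin (m + 2)) with he1
  have e0ne : e0 ≠ 0 := left_ne_zero_of_mul_eq_one h0
  have e1ne : e1 ≠ 0 := left_ne_zero_of_mul_eq_one h1
  obtain ⟨f, hf⟩ := slice p m P
  obtain ⟨N, Q, hQ⟩ := even_poly e0 e1 h0 h1 f
  have s0 : ∀ a b c : ℝ, eval ![-a, -b, c] f = eval ![a, b, c] f := by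
    intro a b c
    rw [← hf, ← hf, ← hG (bv 0) (by rw [Bf_bv, b00, mul_one]; exact e0ne) (a • bv 0)]
    congr 1
    · rw [Rf, Bf_smul, Bf_bv, b00, ← he0]
      ext i; simp; field_simp; ring
    · rw [Rf, Bf_add, Bf_smul, Bf_smul, Bf_bv, Bf_bv, b00, b10, ← he0]
      ext i; simp; field_simp; ring
  have s1 : ∀ a b c : ℝ, eval ![a, b, -c] f = eval ![a, b, c] f := by
    intro a b c
    rw [← hf, ← hf, ← hG (bv 1) (by rw [Bf_bv, b11, mul_one]; exact e1ne) (a • bv 0)]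
    congr 1
    · rw [Rf, Bf_smul, Bf_bv, b01]
      simp
    · rw [Rf, Bf_add, Bf_smul, Bf_smul, Bf_bv, Bf_bv, b11, b01, ← he1]
      ext i; simp; field_simp; ring
  have main : ∀ x y, 0 < e0 * Bf p x x → 0 < e0 * e1 * (Bf p x x * Bf p y y - Bf p x y ^ 2) →
      Bf p x x ^ N * (4 * Gf p P x y) = eval ![Bf p x x, Bf p x y, Bf p y y] Q := by
    intro x y hx hxy
    obtain ⟨a, b, c, hg, hxx, hxy', hyy⟩ := transport p m P hG x y hx hxy
    rw [hg, hxx, hxy', hyy, ← hQ, s1, s0, s1, s0, hf]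
    ring
  refine descend p m N P (C (1 / 4) * Q) ?_
  rw [← sub_eq_zero]
  -- recover y from the covector
  have hrec : ∀ g : Fin (m + 2) ⊕ Fin (m + 2) → ℝ,
      g = Sum.elim (fun i => g (Sum.inl i))
        (fun i => eps p i * (eps p i * g (Sum.inr i))) := by
    intro g
    ext k
    rcases k with k | k
    · rfl
    · simp only [Sum.elim_inr]
      linear_combination - g (Sum.inr k) * eps_sq p k
  refine poly_zero_of_nhds _
    {g | 0 < e0 * Bf p (fun i => g (Sum.inl i)) (fun i => g (Sum.inl i)) ∧
      0 < e0 * e1 * (Bf p (fun i => g (Sum.inl i)) (fun i => g (Sum.inl i)) *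
        Bf p (fun i => eps p i * g (Sum.inr i)) (fun i => eps p i * g (Sum.inr i)) -
        Bf p (fun i => g (Sum.inl i)) (fun i => eps p i * g (Sum.inr i)) ^ 2)} ?_
    (Sum.elim (bv 0) (fun i => eps p i * bv 1 i)) ?_ ?_
  · refine IsOpen.and (isOpen_lt continuous_const ?_) (isOpen_lt continuous_const ?_)
    · unfold Bf; fun_prop
    · unfold Bf; fun_prop
  · have hb : (fun i => eps p i * (eps p i * bv 1 i)) = (bv 1 : Fin (m + 2) → ℝ) := by
      ext i; linear_combination bv 1 i * eps_sq p i
    simp only [Set.mem_ofPred_eq, Sum.elim_inl, Sum.elim_inr]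
    rw [hb]
    change 0 < e0 * Bf p (bv 0) (bv 0) ∧ 0 < e0 * e1 * (Bf p (bv 0) (bv 0) * Bf p (bv 1) (bv 1) -
      Bf p (bv 0) (bv 1) ^ 2)
    rw [Bf_bv, Bf_bv, Bf_bv, b00, b11, b01, ← he0, ← he1]
    constructor
    · nlinarith
    · have : e0 * e1 * (e0 * 1 * (e1 * 1) - (e1 * 0) ^ 2) = 1 := by
        linear_combination e1 * e1 * h0 + h1
      rw [this]; norm_num
  · rintro g ⟨hg1, hg2⟩
    have hm := main _ _ hg1 hg2
    rw [hrec g, map_sub, map_mul, map_pow, eval_inv, eval_aeval_inv, map_mul, eval_C, ← hm, Gf]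
    simp only [Matrix.cons_val_zero]
    ring

lemma even_poly_two (e : ℝ) (h : e * e = 1) (f : MvPolynomial (Fin 1 ⊕ Fin 1) ℝ) :
    ∃ Q : MvPolynomial (Fin 3) ℝ, ∀ a b : ℝ,
      eval (Sum.elim (fun _ => a) (fun _ => e * b)) f +
        eval (Sum.elim (fun _ => -a) (fun _ => e * -b)) f
        = eval ![e * a * a, e * a * b, e * b * b] Q := by
  induction f using MvPolynomial.induction_on' with
  | monomial s r =>
    have hs : ∀ a b : ℝ, eval (Sum.elim (fun _ => a) (fun _ => b)) (monomial s r)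
        = r * (a ^ s (Sum.inl 0) * b ^ s (Sum.inr 0)) := by
      intro a b
      rw [eval_monomial, Finsupp.prod_fintype _ _ (by simp), Fintype.prod_sum_type]; simp
    simp only [hs]
    generalize s (Sum.inl 0) = i
    generalize s (Sum.inr 0) = j
    rcases Nat.even_or_odd' i with ⟨k, rfl | rfl⟩ <;> rcases Nat.even_or_odd' j with ⟨l, rfl | rfl⟩
    · refine ⟨C (2 * r) * (C e * X 0) ^ k * (C e * X 2) ^ l, fun a b => ?_⟩
      have e1' : e * (e * a * a) = a ^ 2 := by linear_combination a ^ 2 * h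
      have e2' : e * (e * b * b) = (e * b) ^ 2 := by ring
      have e3' : (e * -b) = - (e * b) := by ring
      simp only [map_mul, map_pow, eval_C, eval_X, Matrix.cons_val_zero, Matrix.cons_val, e1', e2',
        e3', pow_mul, neg_sq]
      ring
    · exact ⟨0, fun a b => by simp [pow_succ, pow_mul]⟩
    · exact ⟨0, fun a b => by simp [pow_succ, pow_mul]⟩
    · refine ⟨C (2 * r) * (C e * X 0) ^ k * (C e * X 2) ^ l * X 1, fun a b => ?_⟩
      have e1' : e * (e * a * a) = a ^ 2 := by linear_combination a ^ 2 * h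
      have e2' : e * (e * b * b) = (e * b) ^ 2 := by ring
      have e3' : (e * -b) = - (e * b) := by ring
      simp only [map_mul, map_pow, eval_C, eval_X, Matrix.cons_val_zero, Matrix.cons_val_one,
        Matrix.cons_val, e1', e2', e3', pow_mul, neg_sq, pow_succ _ (2 * _)]
      ring
  | add f g hf hg =>
    obtain ⟨Q, hQ⟩ := hf
    obtain ⟨R, hR⟩ := hg
    refine ⟨Q + R, fun a b => ?_⟩
    simp only [map_add, ← hQ, ← hR]
    ring

lemma case_one (p : ℕ) (P : MvPolynomial (Fin 1 ⊕ Fin 1) ℝ)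
    (hG : ∀ z, Bf p z z ≠ 0 → ∀ x y, Gf p P (Rf p z x) (Rf p z y) = Gf p P x y) :
    ∃ Q : MvPolynomial (Fin 3) ℝ, P = aeval (Inv3 p 1) Q := by
  have h0 := eps_sq p (0 : Fin 1)
  have e0ne : eps p (0 : Fin 1) ≠ 0 := left_ne_zero_of_mul_eq_one h0
  obtain ⟨Q, hQ⟩ := even_poly_two (eps p (0 : Fin 1)) h0 P
  refine ⟨C (1 / 2) * Q, ?_⟩
  apply MvPolynomial.funext
  intro g
  have hrec : g = Sum.elim (fun i => g (Sum.inl i))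
        (fun i => eps p i * (eps p i * g (Sum.inr i))) := by
    ext k
    rcases k with k | k
    · rfl
    · simp only [Sum.elim_inr]
      linear_combination - g (Sum.inr k) * eps_sq p k
  have key : ∀ a b : ℝ, Gf p P (fun _ => a) (fun _ => b)
      = eval (Sum.elim (fun _ => a) (fun _ => eps p (0 : Fin 1) * b)) P := by
    intro a b
    unfold Gf
    congr 3
    ext i; rw [Subsingleton.elim i 0]
  have hRf : ∀ a : ℝ, Rf p (bv 0) (fun _ : Fin 1 => a) = fun _ => -a := by
    intro a
    ext i
    rw [Subsingleton.elim i 0]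
    rw [Rf, Bf_bv, Bf_bv]
    simp [bv]
    field_simp; ring
  have sym : ∀ a b : ℝ, Gf p P (fun _ => -a) (fun _ => -b) = Gf p P (fun _ => a) (fun _ => b) := by
    intro a b
    rw [← hG (bv 0) (by rw [Bf_bv]; simp [bv, e0ne]) (fun _ => a), hRf, hRf]
  have hx : (fun i : Fin 1 => g (Sum.inl i)) = fun _ => g (Sum.inl 0) := by
    ext i; rw [Subsingleton.elim i 0]
  have hy : (fun i : Fin 1 => eps p i * g (Sum.inr i))
      = fun _ => eps p (0 : Fin 1) * g (Sum.inr 0) := by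
    ext i; rw [Subsingleton.elim i 0]
  rw [hrec, eval_aeval_inv, map_mul, eval_C, hy, hx]
  have hq := hQ (g (Sum.inl 0)) (eps p (0 : Fin 1) * g (Sum.inr 0))
  rw [← key, ← key, sym] at hq
  simp only [Bf, Fin.sum_univ_one]
  rw [← hq]
  have h3 := key (g (Sum.inl 0)) (eps p (0 : Fin 1) * g (Sum.inr 0))
  rw [h3]
  have h4 : (fun i : Fin 1 => eps p i * (eps p i * g (Sum.inr i)))
      = fun _ => eps p (0 : Fin 1) * (eps p (0 : Fin 1) * g (Sum.inr 0)) := by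
    ext i; rw [Subsingleton.elim i 0]
  rw [h4]
  ring

/-- First fundamental theorem of invariant theory for `O(p,q)` acting on one vector and one
covector: every polynomial `P(x,ξ)` invariant under `(x,ξ) ↦ (Ax, ξ∘A⁻¹)` for all
`A ∈ O(p,q)` is a polynomial in `R_xx = Σ ε_i (x^i)²`, `R_xξ = Σ x^i ξ_i`,
`R_ξξ = Σ ε_i ξ_i²`. Here `Sum.inl` indexes the variables `x^i` and `Sum.inr` the
variables `ξ_i`. -/
theorem opq_invariant_polynomial_vector_covector (p q n : ℕ) (hn : n = p + q) (hn1 : 1 ≤ n)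
    (P : MvPolynomial (Fin n ⊕ Fin n) ℝ)
    (hP : ∀ A : GL (Fin n) ℝ,
      (∀ v : Fin n → ℝ,
        ∑ i, eps p i * (Matrix.mulVec (A : Matrix (Fin n) (Fin n) ℝ) v i) ^ 2
          = ∑ i, eps p i * (v i) ^ 2) →
      ∀ x ξ : Fin n → ℝ,
        eval (Sum.elim (Matrix.mulVec (A : Matrix (Fin n) (Fin n) ℝ) x)
            (Matrix.vecMul ξ ((A⁻¹ : GL (Fin n) ℝ) : Matrix (Fin n) (Fin n) ℝ))) P
          = eval (Sum.elim x ξ) P) :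
    ∃ Q : MvPolynomial (Fin 3) ℝ,
      P = aeval
        ![∑ i, C (eps p i) * X (Sum.inl i) ^ 2,
          ∑ i, X (Sum.inl i) * X (Sum.inr i),
          ∑ i, C (eps p i) * X (Sum.inr i) ^ 2] Q := by
  have hG := Gf_refl p n P hP
  rcases n with _ | _ | m
  · omega
  · exact case_one p P hG
  · exact case_ge_two p m P hG

end
end

section
/- Let O(p,q) denote the group of linear automorphisms A of ℝⁿ preserving the quadratic form Σ_i ε_i (x^i)². Every real polynomial P(ξ,η) in the 2n variables (ξ_1,…,ξ_n, η_1,…,η_n) that is invariant under the diagonal action (ξ,η) ↦ (ξ∘A^{−1}, η∘A^{−1}) of O(p,q) on pairs of covectors is a polynomial in the three invariants R_ξξ = Σ_i ε_i ξ_i², R_ξη = Σ_i ε_i ξ_i η_i, and R_ηη = Σ_i ε_i η_i². -/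
open MvPolynomial

noncomputable section

/-- The diagonal bilinear form. -/
def BF {n : ℕ} (e x y : Fin n → ℝ) : ℝ := ∑ i, e i * x i * y i

lemma BF_comm {n : ℕ} (e x y : Fin n → ℝ) : BF e x y = BF e y x :=
  Finset.sum_congr rfl fun i _ => by ring

lemma BF_add_left {n : ℕ} (e x y z : Fin n → ℝ) : BF e (x + y) z = BF e x z + BF e y z := by
  simp only [BF, ← Finset.sum_add_distrib, Pi.add_apply]
  exact Finset.sum_congr rfl fun i _ => by ring

lemma BF_smul_left {n : ℕ} (e x z : Fin n → ℝ) (k : ℝ) : BF e (k • x) z = k * BF e x z := by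
  simp only [BF, Finset.mul_sum, Pi.smul_apply, smul_eq_mul]
  exact Finset.sum_congr rfl fun i _ => by ring

lemma BF_sub_left {n : ℕ} (e x y z : Fin n → ℝ) : BF e (x - y) z = BF e x z - BF e y z := by
  simp only [BF, ← Finset.sum_sub_distrib, Pi.sub_apply]
  exact Finset.sum_congr rfl fun i _ => by ring

lemma BF_add_right {n : ℕ} (e x y z : Fin n → ℝ) : BF e z (x + y) = BF e z x + BF e z y := by
  simp only [BF_comm e z, BF_add_left]

lemma BF_sub_right {n : ℕ} (e x y z : Fin n → ℝ) : BF e z (x - y) = BF e z x - BF e z y := by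
  simp only [BF_comm e z, BF_sub_left]

lemma BF_smul_right {n : ℕ} (e x z : Fin n → ℝ) (k : ℝ) : BF e z (k • x) = k * BF e z x := by
  simp only [BF_comm e z, BF_smul_left]

/-- The reflection in `u`. -/
def reflV {n : ℕ} (e u x : Fin n → ℝ) : Fin n → ℝ := x - (2 * BF e x u / BF e u u) • u

lemma reflV_of {n : ℕ} {e u x : Fin n → ℝ} (k : ℝ) (hu : BF e u u ≠ 0)
    (h : 2 * BF e x u = k * BF e u u) : reflV e u x = x - k • u := by
  rw [reflV, h, mul_div_assoc, div_self hu, mul_one]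

lemma BF_reflV {n : ℕ} {e u : Fin n → ℝ} (hu : BF e u u ≠ 0) (x y : Fin n → ℝ) :
    BF e (reflV e u x) (reflV e u y) = BF e x y := by
  simp only [reflV, BF_sub_left, BF_sub_right, BF_smul_left, BF_smul_right, BF_comm e u]
  rw [BF_comm e y u]
  field_simp
  rw [BF_comm e u y]
  ring

/-- Reflection invariance of a function of two vectors. -/
def RInv {n : ℕ} (e : Fin n → ℝ) (F : (Fin n → ℝ) → (Fin n → ℝ) → ℝ) : Prop :=
  ∀ u, BF e u u ≠ 0 → ∀ x y, F (reflV e u x) (reflV e u y) = F x y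

lemma witt_one {n : ℕ} {e : Fin n → ℝ} {F : (Fin n → ℝ) → (Fin n → ℝ) → ℝ} (hF : RInv e F)
    (x w y : Fin n → ℝ) (hw : BF e w w ≠ 0) (hx : BF e x x = BF e w w) :
    ∃ y', F x y = F w y' ∧ BF e w y' = BF e x y ∧ BF e y' y' = BF e y y := by
  by_cases h : BF e (x - w) (x - w) = 0
  · have h2 : BF e (x + w) (x + w) ≠ 0 := by
      intro h3
      apply hw
      simp only [BF_sub_left, BF_sub_right, BF_add_left, BF_add_right] at h h3
      linarith
    have e1 : reflV e (x + w) x = x - (1 : ℝ) • (x + w) := by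
      apply reflV_of _ h2
      simp only [BF_add_left, BF_add_right, BF_comm e w x]
      linarith
    have e2 : reflV e w (reflV e (x + w) x) = w := by
      rw [e1, reflV_of (-2) hw]
      · ext i; simp; ring
      · simp only [BF_sub_left, BF_smul_left, BF_add_left]; ring
    refine ⟨reflV e w (reflV e (x + w) y), ?_, ?_, ?_⟩
    · rw [← hF _ h2, ← hF w hw, e2]
    · conv_lhs => rw [← e2]
      rw [e2] 
      conv_lhs => arg 2; rw [← e2]
      rw [BF_reflV hw, BF_reflV h2]
    · rw [BF_reflV hw, BF_reflV h2]
  · have e1 : reflV e (x - w) x = w := by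
      rw [reflV_of 1 h]
      · simp
      · simp only [BF_sub_left, BF_sub_right, BF_comm e w x]
        linarith
    refine ⟨reflV e (x - w) y, ?_, ?_, BF_reflV h _ _⟩
    · rw [← hF _ h, e1]
    · conv_lhs => arg 2; rw [← e1]
      exact BF_reflV h _ _

lemma witt_two {n : ℕ} {e : Fin n → ℝ} {F : (Fin n → ℝ) → (Fin n → ℝ) → ℝ} (hF : RInv e F)
    (w y v : Fin n → ℝ) (hw : BF e w w ≠ 0) (h1 : BF e w y = BF e w v)
    (h2 : BF e y y = BF e v v) (h3 : BF e w w * BF e v v - BF e w v ^ 2 ≠ 0) :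
    F w y = F w v := by
  by_cases h : BF e (y - v) (y - v) = 0
  · obtain ⟨t, ht⟩ : ∃ t, t * BF e w w = BF e w v := ⟨BF e w v / BF e w w, by field_simp⟩
    have hyv : BF e y v = BF e v v := by
      simp only [BF_sub_left, BF_sub_right, BF_comm e v y] at h
      linarith
    have hm : BF e (v - t • w) (v - t • w) ≠ 0 := by
      intro h0
      apply h3
      simp only [BF_sub_left, BF_sub_right, BF_smul_left, BF_smul_right, BF_comm e v w] at h0
      linear_combination BF e w w * h0 + (BF e w v - t * BF e w w) * ht
    have hu : BF e (y + v - (2 * t) • w) (y + v - (2 * t) • w) ≠ 0 := by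
      intro h0
      apply hm
      simp only [BF_sub_left, BF_sub_right, BF_smul_left, BF_smul_right, BF_add_left,
        BF_add_right, BF_comm e v w, BF_comm e y w, BF_comm e v y, hyv, h1, h2] at h0 ⊢
      linear_combination h0 / 4
    have a1 : reflV e (y + v - (2 * t) • w) w = w := by
      rw [reflV_of 0 hu]
      · simp
      · simp only [BF_sub_right, BF_smul_right, BF_add_right, h1]
        linear_combination (-4) * ht
    have a2 : reflV e (y + v - (2 * t) • w) y = (2 * t) • w - v := by
      rw [reflV_of 1 hu]
      · ext i; simp; ring
      · simp only [BF_sub_left, BF_sub_right, BF_smul_left, BF_smul_right, BF_add_left,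
          BF_add_right, BF_comm e v w, BF_comm e y w, BF_comm e v y, hyv, h1, h2]
        linear_combination (-4) * t * ht
    have b1 : reflV e (v - t • w) w = w := by
      rw [reflV_of 0 hm]
      · simp
      · simp only [BF_sub_right, BF_smul_right]
        linear_combination (-2) * ht
    have b2 : reflV e (v - t • w) ((2 * t) • w - v) = v := by
      rw [reflV_of (-2) hm]
      · ext i; simp; ring
      · simp only [BF_sub_left, BF_sub_right, BF_smul_left, BF_smul_right, BF_comm e v w]
        linear_combination (-2) * t * ht
    rw [← hF _ hu w y, a1, a2, ← hF _ hm, b1, b2]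
  · have a1 : reflV e (y - v) w = w := by
      rw [reflV_of 0 h]
      · simp
      · simp only [BF_sub_right, h1]; ring
    have a2 : reflV e (y - v) y = v := by
      rw [reflV_of 1 h]
      · simp
      · simp only [BF_sub_left, BF_sub_right, BF_comm e v y]
        linarith
    rw [← hF _ h, a1, a2]

lemma witt_pair {n : ℕ} {e : Fin n → ℝ} {F : (Fin n → ℝ) → (Fin n → ℝ) → ℝ} (hF : RInv e F)
    (x y w v : Fin n → ℝ) (hw : BF e w w ≠ 0) (h0 : BF e x x = BF e w w)
    (h1 : BF e x y = BF e w v)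
    (h2 : BF e y y = BF e v v) (h3 : BF e w w * BF e v v - BF e w v ^ 2 ≠ 0) :
    F x y = F w v := by
  obtain ⟨y', k1, k2, k3⟩ := witt_one hF x w y hw h0
  rw [k1]
  exact witt_two hF w y' v hw (k2.trans h1) (k3.trans h2) h3

/-- Invariance under the group gives invariance under reflections. -/
lemma rinv_of_group {n : ℕ} (e : Fin n → ℝ) (he : ∀ i, e i * e i = 1)
    (F : (Fin n → ℝ) → (Fin n → ℝ) → ℝ)
    (hP : ∀ A : GL (Fin n) ℝ,
      (∀ v : Fin n → ℝ,
        ∑ i, e i * (Matrix.mulVec (A : Matrix (Fin n) (Fin n) ℝ) v i) ^ 2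
          = ∑ i, e i * (v i) ^ 2) →
      ∀ ξ η : Fin n → ℝ,
        F (Matrix.vecMul ξ ((A⁻¹ : GL (Fin n) ℝ) : Matrix (Fin n) (Fin n) ℝ))
            (Matrix.vecMul η ((A⁻¹ : GL (Fin n) ℝ) : Matrix (Fin n) (Fin n) ℝ))
          = F ξ η) : RInv e F := by
  intro u hu x y
  set S : Matrix (Fin n) (Fin n) ℝ :=
    1 - (2 / BF e u u) • Matrix.vecMulVec (fun i => e i * u i) u with hS
  have hv : ∀ x, Matrix.vecMul x S = reflV e u x := by
    intro x
    rw [hS, Matrix.vecMul_sub, Matrix.vecMul_one, Matrix.vecMul_smul, Matrix.vecMul_vecMulVec,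
      reflV, smul_smul]
    congr 2
    have : x ⬝ᵥ (fun i => e i * u i) = BF e x u :=
      Finset.sum_congr rfl fun i _ => by ring
    rw [this]; ring
  have hinv : ∀ x, reflV e u (reflV e u x) = x := by
    intro x
    conv_lhs => rw [reflV]
    have : BF e (reflV e u x) u = - BF e x u := by
      rw [reflV, BF_sub_left, BF_smul_left]; field_simp; ring
    rw [this, reflV]
    ext i; simp; ring
  have hSS : S * S = 1 := by
    have : ∀ x, Matrix.vecMul x (S * S) = Matrix.vecMul x 1 := by
      intro x
      rw [← Matrix.vecMul_vecMul, hv, hv, hinv, Matrix.vecMul_one]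
    ext i j
    have h := congrFun (this (Pi.single i 1)) j
    rw [Matrix.single_one_vecMul, Matrix.single_one_vecMul] at h
    exact h
  let A : GL (Fin n) ℝ := ⟨S, S, hSS, hSS⟩
  have := hP A ?_ x y
  · have hA : ((A⁻¹ : GL (Fin n) ℝ) : Matrix (Fin n) (Fin n) ℝ) = S := rfl
    rw [hA, hv, hv] at this
    exact this
  · intro v
    change ∑ i, e i * (Matrix.mulVec S v i) ^ 2 = _
    have hm : ∀ i, Matrix.mulVec S v i = v i - 2 / BF e u u * (∑ j, u j * v j) * (e i * u i) := by
      intro i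
      rw [hS, Matrix.sub_mulVec, Matrix.one_mulVec, Matrix.smul_mulVec, Matrix.vecMulVec_mulVec]
      simp [dotProduct]; ring
    simp only [hm]
    set d := ∑ j, u j * v j with hd
    have : ∀ i, e i * (v i - 2 / BF e u u * d * (e i * u i)) ^ 2 = e i * v i ^ 2
       - (4 / BF e u u * d) * (u i * v i) + (2 / BF e u u * d) ^ 2 * (e i * u i * u i) := by
      intro i
      linear_combination (-(4 / BF e u u * d) * u i * v i + (2 / BF e u u * d) ^ 2 *
        (e i * u i * u i)) * he i
    simp only [this, Finset.sum_add_distrib, Finset.sum_sub_distrib, ← Finset.mul_sum]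
    rw [← hd]
    have h2 : ∑ i, e i * u i * u i = BF e u u := rfl
    rw [h2]
    field_simp
    ring

lemma mono3 (e0 e1 : ℝ) (h0 : e0 * e0 = 1) (h1 : e1 * e1 = 1) (D i j k : ℕ)
    (hD : i + j + k ≤ D) (hij : Even (i + j)) (hk : Even k) :
    ∃ M : MvPolynomial (Fin 3) ℝ, ∀ a b c : ℝ,
      eval ![e0 * a ^ 2, e0 * (a * b), e0 * b ^ 2 + e1 * c ^ 2] M
        = (e0 * a ^ 2) ^ D * (a ^ i * b ^ j * c ^ k) := by
  obtain ⟨s, hs⟩ := hij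
  obtain ⟨l, hl⟩ := hk
  obtain ⟨r, hr⟩ : ∃ r, r + j + l = D + s := ⟨D + s - j - l, by omega⟩
  refine ⟨C e0 ^ D * (C e0 * X 1) ^ j * (C e0 * X 0) ^ r *
    (C (e0 * e1) * (X 0 * X 2 - X 1 ^ 2)) ^ l, fun a b c => ?_⟩
  simp only [map_mul, map_pow, map_sub, eval_C, eval_X, Matrix.cons_val]
  have t1 : e0 * (e0 * (a * b)) = a * b := by linear_combination (a * b) * h0
  have t2 : e0 * (e0 * a ^ 2) = a ^ 2 := by linear_combination a ^ 2 * h0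
  have t3 : e0 * e1 * (e0 * a ^ 2 * (e0 * b ^ 2 + e1 * c ^ 2) - (e0 * (a * b)) ^ 2)
      = a ^ 2 * c ^ 2 := by
    linear_combination (e1 * e1 * a ^ 2 * c ^ 2) * h0 + (a ^ 2 * c ^ 2) * h1
  rw [t1, t2, t3, hl]
  have t4 : (a ^ 2) ^ D * a ^ i = a ^ j * (a ^ 2) ^ r * (a ^ 2) ^ l := by
    simp only [← pow_mul, ← pow_add]
    congr 1; omega
  calc _ = e0 ^ D * (a ^ j * (a ^ 2) ^ r * (a ^ 2) ^ l) * b ^ j * (c ^ 2) ^ l := by ring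
    _ = _ := by rw [← t4]; ring

lemma parity3 (e0 e1 : ℝ) (h0 : e0 * e0 = 1) (h1 : e1 * e1 = 1) (f : MvPolynomial (Fin 3) ℝ)
    (s1 : ∀ a b c : ℝ, eval ![-a, -b, c] f = eval ![a, b, c] f)
    (s2 : ∀ a b c : ℝ, eval ![a, b, -c] f = eval ![a, b, c] f) :
    ∃ (D : ℕ) (H : MvPolynomial (Fin 3) ℝ), ∀ a b c : ℝ,
      eval ![e0 * a ^ 2, e0 * (a * b), e0 * b ^ 2 + e1 * c ^ 2] H
        = (e0 * a ^ 2) ^ D * eval ![a, b, c] f := by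
  have key : ∀ m : Fin 3 →₀ ℕ, m ∈ f.support → ∃ M : MvPolynomial (Fin 3) ℝ, ∀ a b c : ℝ,
      eval ![e0 * a ^ 2, e0 * (a * b), e0 * b ^ 2 + e1 * c ^ 2] M
        = (e0 * a ^ 2) ^ f.totalDegree * ((1 + (-1) ^ (m 0 + m 1)) * (1 + (-1) ^ (m 2)) / 4 *
          (a ^ m 0 * b ^ m 1 * c ^ m 2)) := by
    intro m hm
    have hD : m 0 + m 1 + m 2 ≤ f.totalDegree := by
      have := le_totalDegree hm
      rw [Finsupp.sum_fintype _ _ (by simp), Fin.sum_univ_three] at this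
      exact this
    rcases Nat.even_or_odd (m 0 + m 1) with p1 | p1
    · rcases Nat.even_or_odd (m 2) with p2 | p2
      · obtain ⟨M, hM⟩ := mono3 e0 e1 h0 h1 _ _ _ _ hD p1 p2
        refine ⟨M, fun a b c => ?_⟩
        rw [hM, p1.neg_one_pow, p2.neg_one_pow]; ring
      · exact ⟨0, fun a b c => by rw [p2.neg_one_pow]; simp⟩
    · exact ⟨0, fun a b c => by rw [p1.neg_one_pow]; simp⟩
  choose! M hM using key
  refine ⟨f.totalDegree, ∑ m ∈ f.support, C (coeff m f) * M m, fun a b c => ?_⟩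
  have hf : eval ![a, b, c] f = (eval ![a, b, c] f + eval ![-a, -b, c] f +
      (eval ![a, b, -c] f + eval ![-a, -b, -c] f)) / 4 := by
    rw [s1, s1, s2]; ring
  rw [hf, map_sum]
  simp only [eval_eq' _ f, Fin.prod_univ_three, Matrix.cons_val, ← Finset.sum_add_distrib,
    Finset.sum_div, Finset.mul_sum]
  refine Finset.sum_congr rfl fun m hm => ?_
  rw [map_mul, hM m hm, eval_C, neg_pow a, neg_pow b, neg_pow c]
  ring

lemma parity2 (e0 : ℝ) (h0 : e0 * e0 = 1) (f : MvPolynomial (Fin 2) ℝ)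
    (s1 : ∀ a b : ℝ, eval ![-a, -b] f = eval ![a, b] f) :
    ∃ (H : MvPolynomial (Fin 3) ℝ), ∀ a b : ℝ,
      eval ![e0 * a ^ 2, e0 * (a * b), e0 * b ^ 2] H = eval ![a, b] f := by
  have key : ∀ m : Fin 2 →₀ ℕ, m ∈ f.support → ∃ M : MvPolynomial (Fin 3) ℝ, ∀ a b : ℝ,
      eval ![e0 * a ^ 2, e0 * (a * b), e0 * b ^ 2] M
        = ((1 + (-1) ^ (m 0 + m 1)) / 2 * (a ^ m 0 * b ^ m 1)) := by
    intro m hm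
    have t0 : ∀ a : ℝ, e0 * (e0 * a) = a := fun a => by linear_combination a * h0
    rcases Nat.even_or_odd (m 0 + m 1) with p1 | p1
    · rw [p1.neg_one_pow]
      rcases Nat.even_or_odd (m 0) with p2 | p2
      · have p3 : Even (m 1) := by grind
        obtain ⟨s, hs⟩ := p2
        obtain ⟨t, ht⟩ := p3
        refine ⟨(C e0 * X 0) ^ s * (C e0 * X 2) ^ t, fun a b => ?_⟩
        simp only [map_mul, map_pow, eval_C, eval_X, Matrix.cons_val, t0, hs, ht]
        ring
      · have p3 : Odd (m 1) := by grind
        obtain ⟨s, hs⟩ := p2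
        obtain ⟨t, ht⟩ := p3
        refine ⟨(C e0 * X 0) ^ s * (C e0 * X 2) ^ t * (C e0 * X 1), fun a b => ?_⟩
        simp only [map_mul, map_pow, eval_C, eval_X, Matrix.cons_val, t0, hs, ht]
        ring
    · exact ⟨0, fun a b => by rw [p1.neg_one_pow]; simp⟩
  choose! M hM using key
  refine ⟨∑ m ∈ f.support, C (coeff m f) * M m, fun a b => ?_⟩
  have hf : eval ![a, b] f = (eval ![a, b] f + eval ![-a, -b] f) / 2 := by
    rw [s1]; ring
  rw [hf, map_sum]
  simp only [eval_eq' _ f, Fin.prod_univ_two, Matrix.cons_val, ← Finset.sum_add_distrib,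
    Finset.sum_div]
  refine Finset.sum_congr rfl fun m hm => ?_
  rw [map_mul, hM m hm, eval_C, neg_pow a, neg_pow b]
  ring

lemma eq_of_open {σ : Type} [Fintype σ] (G1 G2 : MvPolynomial σ ℝ) (U : Set (σ → ℝ))
    (hU : IsOpen U) (x0 : σ → ℝ) (hx : x0 ∈ U) (h : ∀ x ∈ U, eval x G1 = eval x G2) :
    G1 = G2 := by
  obtain ⟨r, hr, hb⟩ := Metric.isOpen_iff.mp hU x0 hx
  refine MvPolynomial.funext_set (fun i => Metric.ball (x0 i) r) (fun i => ?_) ?_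
  · rw [Real.ball_eq_Ioo]
    exact Set.Ioo_infinite (by linarith)
  · intro x hx
    apply h x (hb _)
    rw [← ball_pi _ hr] at *
    exact hx

/-- The three invariants. -/
def RP {n : ℕ} (e : Fin n → ℝ) : Fin 3 → MvPolynomial (Fin n ⊕ Fin n) ℝ :=
  ![∑ i, C (e i) * X (Sum.inl i) ^ 2,
    ∑ i, C (e i) * X (Sum.inl i) * X (Sum.inr i),
    ∑ i, C (e i) * X (Sum.inr i) ^ 2]

lemma aeval_RP {n : ℕ} (e : Fin n → ℝ) {K : Type} [CommRing K] [Algebra ℝ K]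
    (x y : Fin n → K) (Q : MvPolynomial (Fin 3) ℝ) :
    aeval (Sum.elim x y) (aeval (RP e) Q) = aeval ![∑ i, algebraMap ℝ K (e i) * x i ^ 2,
      ∑ i, algebraMap ℝ K (e i) * x i * y i, ∑ i, algebraMap ℝ K (e i) * y i ^ 2] Q := by
  rw [← AlgHom.comp_apply, comp_aeval]
  congr 2
  ext i
  fin_cases i <;> simp [RP]

lemma eval_RP {n : ℕ} (e : Fin n → ℝ) (x y : Fin n → ℝ) (Q : MvPolynomial (Fin 3) ℝ) :
    eval (Sum.elim x y) (aeval (RP e) Q) = eval ![BF e x x, BF e x y, BF e y y] Q := by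
  have := aeval_RP e x y Q
  simp only [← coe_aeval_eq_eval] at this ⊢
  have hs : ∀ z : Fin n → ℝ, ∑ i, e i * z i ^ 2 = BF e z z := fun z =>
    Finset.sum_congr rfl fun i _ => by ring
  have hs' : ∑ i, e i * x i * y i = BF e x y := rfl
  simp only [Algebra.algebraMap_self, RingHom.id_apply, hs, hs'] at this
  exact this

lemma X_dvd_sub (H : MvPolynomial (Fin 3) ℝ) : X 0 ∣ H - aeval ![0, X 1, X 2] H := by
  induction H using MvPolynomial.induction_on with
  | C a => simp
  | add p q hp hq => 
    rw [map_add, add_sub_add_comm]; exact dvd_add hp hq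
  | mul_X p i hp =>
    rw [map_mul, aeval_X]
    fin_cases i
    · simp
    · simpa [← sub_mul] using Dvd.dvd.mul_right hp _
    · simpa [← sub_mul] using Dvd.dvd.mul_right hp _

lemma exists_t (e0 e1 : ℝ) (h0 : e0 * e0 = 1) (h1 : e1 * e1 = 1) :
    ∃ t : ℂ, (e0 : ℂ) + e1 * t ^ 2 = 0 := by
  rcases mul_self_eq_one_iff.mp h0 with rfl | rfl <;>
  rcases mul_self_eq_one_iff.mp h1 with rfl | rfl
  · exact ⟨Complex.I, by simp⟩
  · exact ⟨1, by simp⟩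
  · exact ⟨1, by simp⟩
  · exact ⟨Complex.I, by simp⟩

lemma sum_two {n : ℕ} {K : Type} [CommRing K] (i0 i1 : Fin n) (h : i0 ≠ i1) (f : Fin n → K)
    (hf : ∀ i, i ≠ i0 → i ≠ i1 → f i = 0) : ∑ i, f i = f i0 + f i1 :=
  Fintype.sum_eq_add i0 i1 h fun i hi => hf i hi.1 hi.2

lemma dvd_of_zero {n : ℕ} (e : Fin n → ℝ) (he : ∀ i, e i * e i = 1) (i0 i1 : Fin n)
    (hne : i0 ≠ i1) (H : MvPolynomial (Fin 3) ℝ)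
    (hd : aeval (RP e) (X 0 : MvPolynomial (Fin 3) ℝ) ∣ aeval (RP e) H) : X 0 ∣ H := by
  suffices h : aeval (![0, X 1, X 2] : Fin 3 → MvPolynomial (Fin 3) ℝ) H = 0 by
    have := X_dvd_sub H
    rwa [h, sub_zero] at this
  obtain ⟨t, ht⟩ := exists_t (e i0) (e i1) (he i0) (he i1)
  obtain ⟨G, hG⟩ := hd
  have he0 : (e i0 : ℂ) * e i0 = 1 := by exact_mod_cast he i0
  refine MvPolynomial.funext_set (fun _ => {x : ℝ | x ≠ 0}) (fun i => ?_) ?_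
  · exact (Set.finite_singleton (0 : ℝ)).infinite_compl
  · intro z hz
    have hz1 : z 1 ≠ 0 := hz 1 (Set.mem_univ _)
    have hz1' : (z 1 : ℂ) ≠ 0 := by exact_mod_cast hz1
    let al : ℂ := z 2 / (2 * z 1)
    let be : ℂ := z 1 * e i0 / 2
    let x : Fin n → ℂ := fun i => if i = i0 then 1 else if i = i1 then t else 0
    let y : Fin n → ℂ := fun i => if i = i0 then al + be else if i = i1 then (al - be) * t else 0
    have hne' := hne.symm
    have r0 : ∑ i, (e i : ℂ) * x i ^ 2 = 0 := by
      rw [sum_two i0 i1 hne _ (by intro i a b; simp [x, a, b])]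
      simp [x, hne']; linear_combination ht
    have r1 : ∑ i, (e i : ℂ) * x i * y i = z 1 := by
      rw [sum_two i0 i1 hne _ (by intro i a b; simp [x, a, b])]
      simp only [x, y, hne', if_true, if_false]
      linear_combination (al - be) * ht + z 1 * he0
    have r2 : ∑ i, (e i : ℂ) * y i ^ 2 = z 2 := by
      rw [sum_two i0 i1 hne _ (by intro i a b; simp [y, a, b])]
      simp only [y, hne', if_true, if_false]
      have : al * be * 4 = z 2 * e i0 := by
        simp only [al, be]; field_simp; ring
      linear_combination (al - be) ^ 2 * ht + e i0 * this + z 2 * he0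
    have h1 := aeval_RP e x y H
    rw [hG, map_mul, aeval_RP] at h1
    simp only [Complex.coe_algebraMap, r0, r1, r2] at h1
    simp only [aeval_X, Matrix.cons_val_zero, zero_mul] at h1
    have h2 : (![0, (z 1 : ℂ), (z 2 : ℂ)] : Fin 3 → ℂ)
        = fun i => algebraMap ℝ ℂ ((![0, z 1, z 2] : Fin 3 → ℝ) i) := by
      ext i; fin_cases i <;> simp
    rw [h2] at h1
    have h3 : aeval (![0, z 1, z 2] : Fin 3 → ℝ) H = 0 := by
      have h4 := aeval_algebraMap_apply (A := ℝ) ℂ (![0, z 1, z 2] : Fin 3 → ℝ) H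
      have h5 := h4.symm.trans h1.symm
      simpa using h5
    rw [map_zero, ← coe_aeval_eq_eval]
    change (aeval z) _ = _
    rw [← AlgHom.comp_apply, comp_aeval, ← h3]
    congr 2
    ext i; fin_cases i <;> simp

lemma RP0_ne {n : ℕ} (e : Fin n → ℝ) (he : ∀ i, e i * e i = 1) (i0 : Fin n) :
    aeval (RP e) (X 0 : MvPolynomial (Fin 3) ℝ) ≠ 0 := by
  intro h
  have := eval_RP e (Pi.single i0 1) (Pi.single i0 1) (X 0)
  rw [h] at this
  simp [BF, Pi.single_apply] at this
  have h2 := he i0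
  rw [← this] at h2
  simp at h2

lemma descend_s9 {n : ℕ} (e : Fin n → ℝ) (he : ∀ i, e i * e i = 1) (i0 i1 : Fin n)
    (hne : i0 ≠ i1) (P : MvPolynomial (Fin n ⊕ Fin n) ℝ) (D : ℕ) :
    ∀ H : MvPolynomial (Fin 3) ℝ, aeval (RP e) H = aeval (RP e) (X 0 : MvPolynomial (Fin 3) ℝ) ^ D * P →
      ∃ Q : MvPolynomial (Fin 3) ℝ, P = aeval (RP e) Q := by
  induction D with
  | zero => intro H h; exact ⟨H, by simpa using h.symm⟩
  | succ D ih =>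
    intro H h
    obtain ⟨G, rfl⟩ := dvd_of_zero e he i0 i1 hne H ⟨aeval (RP e) (X 0 : MvPolynomial (Fin 3) ℝ) ^ D * P, by
      rw [h]; ring⟩
    apply ih G
    apply mul_left_cancel₀ (RP0_ne e he i0)
    rw [← map_mul, h]; ring

lemma BF_single_left {n : ℕ} (e y : Fin n → ℝ) (i : Fin n) (a : ℝ) :
    BF e (Pi.single i a) y = e i * a * y i := by
  simp [BF, Pi.single_apply]

lemma main_two {n : ℕ} (e : Fin n → ℝ) (he : ∀ i, e i * e i = 1) (i0 i1 : Fin n)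
    (hne : i0 ≠ i1) (P : MvPolynomial (Fin n ⊕ Fin n) ℝ)
    (hF : RInv e fun x y => eval (Sum.elim x y) P) : ∃ Q : MvPolynomial (Fin 3) ℝ, P = aeval (RP e) Q := by
  have hne' := hne.symm
  have en : ∀ i, e i ≠ 0 := fun i h => by have := he i; simp [h] at this
  let f : MvPolynomial (Fin 3) ℝ := aeval (Sum.elim (Pi.single i0 (X 0))
    (Pi.single i0 (X 1) + Pi.single i1 (X 2))) P
  have hf : ∀ a b c : ℝ, eval ![a, b, c] f = eval (Sum.elim (Pi.single i0 a)
      (Pi.single i0 b + Pi.single i1 c)) P := by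
    intro a b c
    simp only [f, ← coe_aeval_eq_eval]
    change aeval _ _ = aeval _ _
    rw [← AlgHom.comp_apply, comp_aeval]
    congr 2
    ext i
    rcases i with i | i
    · by_cases h : i = i0 <;> simp [Pi.single_apply, h]
    · by_cases h : i = i0 <;> by_cases h' : i = i1 <;> simp [Pi.single_apply, h, h', hne, hne']
  have hu : ∀ i, BF e (Pi.single i 1) (Pi.single i 1) ≠ 0 := by
    intro i; rw [BF_single_left]; simpa using en i
  have hr : ∀ i y, reflV e (Pi.single i 1) y = y - (2 * y i) • Pi.single i 1 := by
    intro i y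
    apply reflV_of _ (hu i)
    rw [BF_comm, BF_single_left, BF_single_left]; simp; ring
  obtain ⟨D, H, hH⟩ := parity3 (e i0) (e i1) (he i0) (he i1) f (by
      intro a b c
      have := hF _ (hu i0) (Pi.single i0 a) (Pi.single i0 b + Pi.single i1 c)
      rw [hf, hf]
      refine Eq.trans ?_ this
      congr 3
      · rw [hr]; ext i; by_cases h : i = i0 <;> simp [Pi.single_apply, h]; ring
      · rw [hr]; ext i; by_cases h : i = i0 <;> simp [Pi.single_apply, h, hne]; ring) (by
      intro a b c
      have := hF _ (hu i1) (Pi.single i0 a) (Pi.single i0 b + Pi.single i1 c)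
      rw [hf, hf]
      refine Eq.trans ?_ this
      congr 3
      · rw [hr]; ext i; by_cases h : i = i1 <;> simp [Pi.single_apply, h, hne']
      · rw [hr]; ext i; by_cases h : i = i1 <;> simp [Pi.single_apply, h, hne']; ring)
  refine descend_s9 e he i0 i1 hne P D H ?_
  let xx : (Fin n ⊕ Fin n → ℝ) → Fin n → ℝ := fun z i => z (Sum.inl i)
  let yy : (Fin n ⊕ Fin n → ℝ) → Fin n → ℝ := fun z i => z (Sum.inr i)
  have hz : ∀ z, Sum.elim (xx z) (yy z) = z := by
    intro z; ext i; rcases i with i | i <;> rfl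
  refine eq_of_open _ _ {z | 0 < e i0 * BF e (xx z) (xx z) ∧ 0 < e i0 * e i1 *
    (BF e (xx z) (xx z) * BF e (yy z) (yy z) - BF e (xx z) (yy z) ^ 2)} ?_
    (Sum.elim (Pi.single i0 1) (Pi.single i1 1)) ?_ ?_
  · rw [Set.ofPred_and]
    apply IsOpen.inter
    · apply isOpen_lt continuous_const
      simp only [BF, xx]; fun_prop
    · apply isOpen_lt continuous_const
      simp only [BF, xx, yy]; fun_prop
  · have h1 : xx (Sum.elim (Pi.single i0 1) (Pi.single i1 1)) = Pi.single i0 1 := rfl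
    have h2 : yy (Sum.elim (Pi.single i0 1) (Pi.single i1 1)) = Pi.single i1 1 := rfl
    simp only [Set.mem_ofPred_eq, h1, h2, BF_single_left]
    simp [he, hne]
    exact ⟨en _, en _⟩
  · rintro z ⟨z1, z2⟩
    rw [map_mul, map_pow]
    conv_lhs => rw [← hz z]
    conv_rhs => rw [← hz z]
    generalize xx z = x at z1 z2 ⊢
    generalize yy z = y at z1 z2 ⊢
    rw [eval_RP, eval_RP, eval_X, Matrix.cons_val_zero]
    obtain ⟨a, ha, ha2⟩ : ∃ a : ℝ, 0 < a ∧ a ^ 2 = e i0 * BF e x x :=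
      ⟨√(e i0 * BF e x x), Real.sqrt_pos.mpr z1, Real.sq_sqrt z1.le⟩
    have hxx : BF e x x = e i0 * a ^ 2 := by
      rw [ha2]; linear_combination (-BF e x x) * he i0
    obtain ⟨b, hb⟩ : ∃ b : ℝ, a * b = e i0 * BF e x y := ⟨e i0 * BF e x y / a, by field_simp⟩
    have hxy : BF e x y = e i0 * (a * b) := by
      rw [hb]; linear_combination (-BF e x y) * he i0
    have z3 : 0 < e i1 * (BF e y y - e i0 * b ^ 2) := by
      have : 0 < a ^ 2 * (e i1 * (BF e y y - e i0 * b ^ 2)) := by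
        rw [hxx, hxy] at z2
        calc 0 < _ := z2
          _ = _ := by
            linear_combination (a ^ 2 * e i1 * (BF e y y - e i0 * b ^ 2)) * he i0
      exact pos_of_mul_pos_right this (by positivity)
    obtain ⟨c, hc, hc2⟩ : ∃ c : ℝ, 0 < c ∧ c ^ 2 = e i1 * (BF e y y - e i0 * b ^ 2) :=
      ⟨√(e i1 * (BF e y y - e i0 * b ^ 2)), Real.sqrt_pos.mpr z3, Real.sq_sqrt z3.le⟩
    have hyy : BF e y y = e i0 * b ^ 2 + e i1 * c ^ 2 := by
      rw [hc2]; linear_combination (-(BF e y y - e i0 * b ^ 2)) * he i1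
    have w1 : BF e (Pi.single i0 a) (Pi.single i0 a) = e i0 * a ^ 2 := by
      rw [BF_single_left]; simp; ring
    have w2 : BF e (Pi.single i0 a) (Pi.single i0 b + Pi.single i1 c) = e i0 * (a * b) := by
      rw [BF_single_left]; simp [hne]; ring
    have w3 : BF e (Pi.single i0 b + Pi.single i1 c) (Pi.single i0 b + Pi.single i1 c)
        = e i0 * b ^ 2 + e i1 * c ^ 2 := by
      rw [BF_add_left, BF_single_left, BF_single_left]; simp [hne, hne']; ring
    have key := witt_pair hF x y (Pi.single i0 a) (Pi.single i0 b + Pi.single i1 c)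
      (by rw [w1]; exact mul_ne_zero (en _) (by positivity)) (by rw [w1, hxx])
      (by rw [w2, hxy]) (by rw [w3, hyy]) (by
        rw [w1, w2, w3]
        have : e i0 * a ^ 2 * (e i0 * b ^ 2 + e i1 * c ^ 2) - (e i0 * (a * b)) ^ 2
          = e i0 * e i1 * (a ^ 2 * c ^ 2) := by ring
        rw [this]
        exact mul_ne_zero (mul_ne_zero (en _) (en _)) (by positivity))
    rw [key, hxx, hxy, hyy, hH, hf]

lemma main_one (e : Fin 1 → ℝ) (he : ∀ i, e i * e i = 1)
    (P : MvPolynomial (Fin 1 ⊕ Fin 1) ℝ)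
    (hF : RInv e fun x y => eval (Sum.elim x y) P) : ∃ Q : MvPolynomial (Fin 3) ℝ, P = aeval (RP e) Q := by
  let f : MvPolynomial (Fin 2) ℝ := aeval (Sum.elim (fun _ => X 0) (fun _ => X 1)) P
  have hf : ∀ a b : ℝ, eval ![a, b] f = eval (Sum.elim (fun _ => a) (fun _ => b)) P := by
    intro a b
    simp only [f, ← coe_aeval_eq_eval]
    change aeval _ _ = aeval _ _
    rw [← AlgHom.comp_apply, comp_aeval]
    congr 2
    ext i
    rcases i with i | i <;> simp
  have en : e 0 ≠ 0 := fun h => by have := he 0; simp [h] at this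
  have hu : BF e (fun _ => 1) (fun _ => 1) ≠ 0 := by simpa [BF] using en
  have hr : ∀ a : ℝ, reflV e (fun _ => 1) (fun _ => a) = fun _ => -a := by
    intro a
    rw [reflV_of (2 * a) hu]
    · ext i; simp; ring
    · simp [BF]; ring
  obtain ⟨H, hH⟩ := parity2 (e 0) (he 0) f (by
    intro a b
    rw [hf, hf]
    have := hF _ hu (fun _ => a) (fun _ => b)
    simpa only [hr] using this)
  refine ⟨H, MvPolynomial.funext fun z => ?_⟩
  have hz : z = Sum.elim (fun _ => z (Sum.inl 0)) (fun _ => z (Sum.inr 0)) := by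
    ext i; rcases i with i | i <;> simp [Subsingleton.elim i 0]
  rw [hz, eval_RP, ← hf, ← hH]
  congr 2
  simp [BF]
  ring_nf
  simp

/-- First fundamental theorem of invariant theory for `O(p,q)` acting diagonally on two
covectors: every polynomial `P(ξ,η)` invariant under `(ξ,η) ↦ (ξ∘A⁻¹, η∘A⁻¹)` for all
`A ∈ O(p,q)` is a polynomial in `R_ξξ = Σ ε_i ξ_i²`, `R_ξη = Σ ε_i ξ_i η_i`,
`R_ηη = Σ ε_i η_i²`. Here `Sum.inl` indexes the variables `ξ_i` and `Sum.inr` the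
variables `η_i`. -/
theorem opq_invariant_polynomial_two_covectors (p q n : ℕ) (hn : n = p + q) (hn1 : 1 ≤ n)
    (P : MvPolynomial (Fin n ⊕ Fin n) ℝ)
    (hP : ∀ A : GL (Fin n) ℝ,
      (∀ v : Fin n → ℝ,
        ∑ i, eps p i * (Matrix.mulVec (A : Matrix (Fin n) (Fin n) ℝ) v i) ^ 2
          = ∑ i, eps p i * (v i) ^ 2) →
      ∀ ξ η : Fin n → ℝ,
        eval (Sum.elim (Matrix.vecMul ξ ((A⁻¹ : GL (Fin n) ℝ) : Matrix (Fin n) (Fin n) ℝ))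
            (Matrix.vecMul η ((A⁻¹ : GL (Fin n) ℝ) : Matrix (Fin n) (Fin n) ℝ))) P
          = eval (Sum.elim ξ η) P) :
    ∃ Q : MvPolynomial (Fin 3) ℝ,
      P = aeval
        ![∑ i, C (eps p i) * X (Sum.inl i) ^ 2,
          ∑ i, C (eps p i) * X (Sum.inl i) * X (Sum.inr i),
          ∑ i, C (eps p i) * X (Sum.inr i) ^ 2] Q := by
  have he : ∀ i : Fin n, eps p i * eps p i = 1 := by
    intro i; unfold eps; split_ifs <;> norm_num
  have hF : RInv (fun i : Fin n => eps p i) fun x y => eval (Sum.elim x y) P :=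
    rinv_of_group _ he _ hP
  change ∃ Q : MvPolynomial (Fin 3) ℝ, P = aeval (RP (fun i : Fin n => eps p i)) Q
  rcases Nat.lt_or_ge 1 n with h | h
  · exact main_two _ he ⟨0, by omega⟩ ⟨1, h⟩ (by simp) P hF
  · obtain rfl : n = 1 := by omega
    exact main_one _ he P hF

end
end
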